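/- Let α ∈ (0,1) and let (u_n)_{n∈ℕ} be a sequence of continuously differentiable functions u_n : 𝕋 × [0,1] → ℝ with u_n(θ,0) = u_n(θ,1) = 0 for all θ ∈ 𝕋, such that sup_n ∫_𝕋 ∫_0^1 ((∂_θ u_n)² + r^α (∂_r u_n)²) dr dθ < +∞. Then there exists a subsequence of (u_n) that is Cauchy (hence convergent) in L²(𝕋 × (0,1)). -/

import Mathlib

open MeasureTheory Set Filter Topology

/-- `f` is continuously differentiable on the strip `ℝ × [0,1]`, with partial derivatives `p`
and `q`, vanishes at `r = 0`, and its degenerate Dirichlet energies over `(0,T) × (0,1)` are at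
most `B`. The values outside the strip only have to be continuous. -/
structure HasEnergyBound (α T B : ℝ) (f p q : ℝ → ℝ → ℝ) : Prop where
  cont : Continuous f.uncurry
  cont_left : Continuous p.uncurry
  cont_right : Continuous q.uncurry
  hasDerivAt_left : ∀ θ r, HasDerivAt (fun x => f x r) (p θ r) θ
  hasDerivAt_right : ∀ θ, ∀ r ∈ Ioo (0 : ℝ) 1, HasDerivAt (f θ) (q θ r) r
  zero : ∀ θ, f θ 0 = 0
  energy_left : ∫ r in (0 : ℝ)..1, ∫ θ in (0 : ℝ)..T, p θ r ^ 2 ≤ B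
  energy_right : ∫ θ in (0 : ℝ)..T, ∫ r in (0 : ℝ)..1, r ^ α * q θ r ^ 2 ≤ B

lemma continuous_integral_left {f : ℝ → ℝ → ℝ} (hf : Continuous f.uncurry) (a b : ℝ) :
    Continuous fun θ => ∫ r in a..b, f θ r :=
  intervalIntegral.continuous_parametric_intervalIntegral_of_continuous' hf a b

lemma integral_integral_mono {f g : ℝ → ℝ → ℝ} (hf : Continuous f.uncurry)
    (hg : Continuous g.uncurry) {a b c d : ℝ} (hab : a ≤ b) (hcd : c ≤ d)
    (h : ∀ x ∈ Icc a b, ∀ y ∈ Icc c d, f x y ≤ g x y) :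
    ∫ x in a..b, ∫ y in c..d, f x y ≤ ∫ x in a..b, ∫ y in c..d, g x y := by
  refine intervalIntegral.integral_mono_on hab
    ((continuous_integral_left hf c d).intervalIntegrable _ _)
    ((continuous_integral_left hg c d).intervalIntegrable _ _) fun x hx => ?_
  exact intervalIntegral.integral_mono_on hcd
    ((hf.comp (Continuous.prodMk_right x)).intervalIntegrable _ _)
    ((hg.comp (Continuous.prodMk_right x)).intervalIntegrable _ _) (h x hx)

lemma integral_integral_swap_of_continuous {f : ℝ → ℝ → ℝ} (hf : Continuous f.uncurry)
    (a b c d : ℝ) :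
    ∫ x in a..b, ∫ y in c..d, f x y = ∫ y in c..d, ∫ x in a..b, f x y := by
  refine intervalIntegral_intervalIntegral_swap ?_
  exact (hf.continuousOn.integrableOn_compact
    ((isCompact_uIcc (a := a) (b := b)).prod (isCompact_uIcc (a := c) (b := d)))).mono_set
    (prod_mono uIoc_subset_uIcc uIoc_subset_uIcc)

lemma integral_integral_mul_sub_sq_le {w f g : ℝ → ℝ → ℝ} (hw : Continuous w.uncurry)
    (hf : Continuous f.uncurry) (hg : Continuous g.uncurry) {a b c d : ℝ} (hab : a ≤ b)
    (hcd : c ≤ d) (hw0 : ∀ x ∈ Icc a b, ∀ y ∈ Icc c d, 0 ≤ w x y) :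
    ∫ x in a..b, ∫ y in c..d, w x y * (f x y - g x y) ^ 2 ≤
      2 * (∫ x in a..b, ∫ y in c..d, w x y * f x y ^ 2) +
        2 * ∫ x in a..b, ∫ y in c..d, w x y * g x y ^ 2 := by
  have hwf : Continuous (fun x y => w x y * f x y ^ 2).uncurry := hw.mul (hf.pow 2)
  have hwg : Continuous (fun x y => w x y * g x y ^ 2).uncurry := hw.mul (hg.pow 2)
  have hwd : Continuous (fun x y => w x y * (f x y - g x y) ^ 2).uncurry :=
    hw.mul ((hf.sub hg).pow 2)
  have hsum : Continuous
      (fun x y => 2 * (w x y * f x y ^ 2) + 2 * (w x y * g x y ^ 2)).uncurry :=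
    (hwf.const_mul 2).add (hwg.const_mul 2)
  have key := integral_integral_mono (f := fun x y => w x y * (f x y - g x y) ^ 2)
    (g := fun x y => 2 * (w x y * f x y ^ 2) + 2 * (w x y * g x y ^ 2))
    hwd hsum hab hcd
    fun x hx y hy => by
      nlinarith [mul_nonneg (hw0 x hx y hy) (sq_nonneg (f x y + g x y))]
  refine key.trans_eq ?_
  have inner (x : ℝ) : ∫ y in c..d, (2 * (w x y * f x y ^ 2) + 2 * (w x y * g x y ^ 2)) =
      2 * (∫ y in c..d, w x y * f x y ^ 2) + 2 * ∫ y in c..d, w x y * g x y ^ 2 := by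
    rw [intervalIntegral.integral_add, intervalIntegral.integral_const_mul,
      intervalIntegral.integral_const_mul]
    · exact ((hwf.comp (Continuous.prodMk_right x)).const_mul 2).intervalIntegrable _ _
    · exact ((hwg.comp (Continuous.prodMk_right x)).const_mul 2).intervalIntegrable _ _
  simp_rw [inner]
  rw [intervalIntegral.integral_add, intervalIntegral.integral_const_mul,
    intervalIntegral.integral_const_mul]
  · exact ((continuous_integral_left hwf c d).const_mul 2).intervalIntegrable _ _
  · exact ((continuous_integral_left hwg c d).const_mul 2).intervalIntegrable _ _

namespace HasEnergyBound

variable {α T B : ℝ} {f p q f' p' q' : ℝ → ℝ → ℝ}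

lemma continuous_weighted (h : HasEnergyBound α T B f p q) (hα : 0 ≤ α) :
    Continuous (fun θ r => r ^ α * q θ r ^ 2).uncurry :=
  ((Real.continuous_rpow_const hα).comp continuous_snd).mul (h.cont_right.pow 2)

lemma continuous_slice (h : HasEnergyBound α T B f p q) (r : ℝ) : Continuous fun t => f t r :=
  h.cont.comp (Continuous.prodMk_left r)

lemma continuous_left_slice (h : HasEnergyBound α T B f p q) (r : ℝ) : Continuous fun t => p t r :=
  h.cont_left.comp (Continuous.prodMk_left r)

lemma sub (h : HasEnergyBound α T B f p q) (h' : HasEnergyBound α T B f' p' q') (hα : 0 ≤ α)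
    (hT : 0 ≤ T) :
    HasEnergyBound α T (4 * B) (fun θ r => f θ r - f' θ r) (fun θ r => p θ r - p' θ r)
      (fun θ r => q θ r - q' θ r) where
  cont := h.cont.sub h'.cont
  cont_left := h.cont_left.sub h'.cont_left
  cont_right := h.cont_right.sub h'.cont_right
  hasDerivAt_left θ r := (h.hasDerivAt_left θ r).sub (h'.hasDerivAt_left θ r)
  hasDerivAt_right θ r hr := (h.hasDerivAt_right θ r hr).sub (h'.hasDerivAt_right θ r hr)
  zero θ := by simp [h.zero, h'.zero]
  energy_left := by
    have := integral_integral_mul_sub_sq_le (w := fun _ _ => 1) (f := fun r θ => p θ r)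
      (g := fun r θ => p' θ r) continuous_const (h.cont_left.comp continuous_swap)
      (h'.cont_left.comp continuous_swap) zero_le_one hT fun _ _ _ _ => zero_le_one
    simp only [one_mul] at this
    linarith [h.energy_left, h'.energy_left]
  energy_right := by
    have := integral_integral_mul_sub_sq_le (w := fun _ r => r ^ α)
      ((Real.continuous_rpow_const hα).comp continuous_snd) h.cont_right h'.cont_right hT
      zero_le_one fun _ _ r hr => Real.rpow_nonneg hr.1 α
    linarith [h.energy_right, h'.energy_right]

lemma abs_sub_le (h : HasEnergyBound α T B f p q) (hα : α ∈ Ioo (0 : ℝ) 1) {l : ℝ} (hl : 0 < l)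
    (θ : ℝ) {r s : ℝ} (hr : r ∈ Icc (0 : ℝ) 1) (hs : s ∈ Icc (0 : ℝ) 1) :
    |f θ r - f θ s| ≤
      (l * (|r - s| ^ (1 - α) / (1 - α)) + (∫ t in (0 : ℝ)..1, t ^ α * q θ t ^ 2) / l) / 2 := by
  wlog hsr : s ≤ r generalizing r s
  · rw [abs_sub_comm, abs_sub_comm r]
    exact this hs hr (le_of_not_ge hsr)
  have hα1 : 0 < 1 - α := sub_pos.2 hα.2
  have hqc : Continuous (q θ) := h.cont_right.comp (Continuous.prodMk_right θ)
  have hwc : Continuous fun t => t ^ α * q θ t ^ 2 :=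
    (h.continuous_weighted hα.1.le).comp (Continuous.prodMk_right θ)
  have hftc : ∫ t in s..r, q θ t = f θ r - f θ s :=
    intervalIntegral.integral_eq_sub_of_hasDerivAt_of_le hsr
      (h.cont.comp (Continuous.prodMk_right θ)).continuousOn
      (fun x hx => h.hasDerivAt_right θ x ⟨hs.1.trans_lt hx.1, hx.2.trans_le hr.2⟩)
      (hqc.intervalIntegrable _ _)
  have hpow : IntervalIntegrable (fun t : ℝ => t ^ (-α)) volume s r :=
    intervalIntegral.intervalIntegrable_rpow' (by linarith [hα.2])
  have hbound : ‖∫ t in s..r, q θ t‖ ≤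
      ∫ t in s..r, (l / 2 * t ^ (-α) + (2 * l)⁻¹ * (t ^ α * q θ t ^ 2)) := by
    refine intervalIntegral.norm_integral_le_of_norm_le hsr (ae_of_all _ fun t ht => ?_)
      ((hpow.const_mul _).add ((hwc.intervalIntegrable _ _).const_mul _))
    have ht0 : 0 < t := hs.1.trans_lt ht.1
    have ha : 0 < t ^ α := Real.rpow_pos_of_pos ht0 α
    rw [Real.norm_eq_abs, Real.rpow_neg ht0.le, ← sq_abs (q θ t)]
    set a := t ^ α
    set x := |q θ t|
    have : l / 2 * a⁻¹ + (2 * l)⁻¹ * (a * x ^ 2) - x = (l - a * x) ^ 2 / (2 * l * a) := by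
      field_simp
      ring
    have h2 : 0 ≤ (l - a * x) ^ 2 / (2 * l * a) := by positivity
    linarith
  rw [← hftc, ← Real.norm_eq_abs]
  refine hbound.trans ?_
  rw [intervalIntegral.integral_add (hpow.const_mul _) ((hwc.intervalIntegrable _ _).const_mul _),
    intervalIntegral.integral_const_mul, intervalIntegral.integral_const_mul,
    integral_rpow (Or.inl (by linarith [hα.2]))]
  have hmono : ∫ t in s..r, t ^ α * q θ t ^ 2 ≤ ∫ t in (0 : ℝ)..1, t ^ α * q θ t ^ 2 := by
    refine intervalIntegral.integral_mono_interval hs.1 hsr hr.2 ?_ (hwc.intervalIntegrable _ _)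
    filter_upwards [ae_restrict_mem measurableSet_Ioc] with t ht
    exact mul_nonneg (Real.rpow_nonneg ht.1.le α) (sq_nonneg _)
  have hsub : r ^ (1 - α) - s ^ (1 - α) ≤ |r - s| ^ (1 - α) := by
    have := Real.rpow_add_le_add_rpow (p := 1 - α) (sub_nonneg.2 hsr) hs.1 hα1.le
      (by linarith [hα.1])
    rw [sub_add_cancel] at this
    rw [abs_of_nonneg (sub_nonneg.2 hsr)]
    linarith
  rw [show -α + 1 = 1 - α by ring]
  have e1 : l / 2 * ((r ^ (1 - α) - s ^ (1 - α)) / (1 - α)) ≤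
      l / 2 * (|r - s| ^ (1 - α) / (1 - α)) := by gcongr
  have e2 : (2 * l)⁻¹ * (∫ t in s..r, t ^ α * q θ t ^ 2) ≤
      (2 * l)⁻¹ * ∫ t in (0 : ℝ)..1, t ^ α * q θ t ^ 2 := by gcongr
  refine (add_le_add e1 e2).trans_eq ?_
  field_simp

lemma continuous_weightedEnergy (h : HasEnergyBound α T B f p q) (hα : 0 ≤ α) :
    Continuous fun θ => ∫ t in (0 : ℝ)..1, t ^ α * q θ t ^ 2 :=
  continuous_integral_left (h.continuous_weighted hα) 0 1

lemma weightedEnergy_nonneg (q : ℝ → ℝ → ℝ) (θ : ℝ) :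
    0 ≤ ∫ t in (0 : ℝ)..1, t ^ α * q θ t ^ 2 :=
  intervalIntegral.integral_nonneg zero_le_one fun _ ht =>
    mul_nonneg (Real.rpow_nonneg ht.1 α) (sq_nonneg _)

lemma bound_nonneg (h : HasEnergyBound α T B f p q) (hT : 0 ≤ T) : 0 ≤ B :=
  (intervalIntegral.integral_nonneg hT fun θ _ => weightedEnergy_nonneg q θ).trans h.energy_right

lemma abs_integral_sub_le (h : HasEnergyBound α T B f p q) (hα : α ∈ Ioo (0 : ℝ) 1) {l : ℝ}
    (hl : 0 < l) {r s : ℝ} (hr : r ∈ Icc (0 : ℝ) 1) (hs : s ∈ Icc (0 : ℝ) 1) {x y : ℝ}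
    (hy : 0 ≤ y) (hyx : y ≤ x) (hx : x ≤ T) :
    |∫ t in y..x, (f t r - f t s)| ≤
      (l * (|r - s| ^ (1 - α) / (1 - α)) * (x - y) + B / l) / 2 := by
  have hG := h.continuous_weightedEnergy hα.1.le
  have hle : ‖∫ t in y..x, (f t r - f t s)‖ ≤ ∫ t in y..x, (l * (|r - s| ^ (1 - α) / (1 - α)) +
      (∫ v in (0 : ℝ)..1, v ^ α * q t v ^ 2) / l) / 2 :=
    intervalIntegral.norm_integral_le_of_norm_le hyx
      (ae_of_all _ fun t _ => h.abs_sub_le hα hl t hr hs)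
      (((continuous_const.add (hG.div_const l)).div_const 2).intervalIntegrable _ _)
  refine hle.trans ?_
  rw [intervalIntegral.integral_div, intervalIntegral.integral_add
    (continuous_const.intervalIntegrable _ _) ((hG.div_const l).intervalIntegrable _ _),
    intervalIntegral.integral_div, intervalIntegral.integral_const, smul_eq_mul,
    mul_comm (x - y)]
  gcongr
  refine le_trans ?_ h.energy_right
  exact intervalIntegral.integral_mono_interval hy hyx hx
    (ae_of_all _ fun t => weightedEnergy_nonneg q t) (hG.intervalIntegrable _ _)

lemma abs_primitive_sub_le (h : HasEnergyBound α T B f p q) (hα : α ∈ Ioo (0 : ℝ) 1) {r s : ℝ}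
    (hr : r ∈ Icc (0 : ℝ) 1) (hs : s ∈ Icc (0 : ℝ) 1) {x y : ℝ} (hx : x ∈ Icc 0 T)
    (hy : y ∈ Icc 0 T) :
    |(∫ t in (0 : ℝ)..x, f t r) - ∫ t in (0 : ℝ)..y, f t s| ≤
      (T / (1 - α) + 1 / (1 - α) + B) * (|x - y| ^ (1 / 2 : ℝ) + |r - s| ^ ((1 - α) / 2)) := by
  have hα1 : 0 < 1 - α := sub_pos.2 hα.2
  have hT : 0 ≤ T := hx.1.trans hx.2
  have hB := h.bound_nonneg hT
  have hint (r a b : ℝ) : IntervalIntegrable (fun t => f t r) volume a b :=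
    (h.continuous_slice r).intervalIntegrable a b
  have vertical : |(∫ t in (0 : ℝ)..x, f t r) - ∫ t in (0 : ℝ)..x, f t s| ≤
      (T / (1 - α) + 1 / (1 - α) + B) * |r - s| ^ ((1 - α) / 2) := by
    rcases eq_or_ne r s with rfl | hne
    · simp only [sub_self, abs_zero]
      positivity
    have hd : 0 < |r - s| := abs_pos.2 (sub_ne_zero.2 hne)
    have hm : 0 < |r - s| ^ ((1 - α) / 2) := Real.rpow_pos_of_pos hd _
    have hsq : |r - s| ^ (1 - α) = |r - s| ^ ((1 - α) / 2) * |r - s| ^ ((1 - α) / 2) := by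
      rw [← Real.rpow_add hd]
      ring_nf
    rw [← intervalIntegral.integral_sub (hint _ _ _) (hint _ _ _)]
    refine (h.abs_integral_sub_le hα (inv_pos.2 hm) hr hs le_rfl hx.1 hx.2).trans ?_
    rw [hsq]
    set m := |r - s| ^ ((1 - α) / 2)
    have e : (m⁻¹ * (m * m / (1 - α)) * (x - 0) + B / m⁻¹) / 2 = (x / (1 - α) + B) / 2 * m := by
      field_simp
      ring
    rw [e]
    gcongr
    have : x / (1 - α) ≤ T / (1 - α) := by gcongr; exact hx.2
    have : 0 ≤ T / (1 - α) := by positivity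
    have : 0 ≤ 1 / (1 - α) := by positivity
    linarith
  have horizontal : |(∫ t in (0 : ℝ)..x, f t s) - ∫ t in (0 : ℝ)..y, f t s| ≤
      (T / (1 - α) + 1 / (1 - α) + B) * |x - y| ^ (1 / 2 : ℝ) := by
    clear vertical
    wlog hyx : y ≤ x generalizing x y
    · rw [abs_sub_comm, abs_sub_comm x]
      exact this hy hx (le_of_not_ge hyx)
    rw [intervalIntegral.integral_interval_sub_left (hint _ _ _) (hint _ _ _)]
    rcases eq_or_ne x y with rfl | hne
    · simp only [sub_self, abs_zero, intervalIntegral.integral_same]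
      positivity
    have hd : 0 < |x - y| := abs_pos.2 (sub_ne_zero.2 hne)
    have hm : 0 < |x - y| ^ (1 / 2 : ℝ) := Real.rpow_pos_of_pos hd _
    have hsq : x - y = |x - y| ^ (1 / 2 : ℝ) * |x - y| ^ (1 / 2 : ℝ) := by
      rw [← Real.rpow_add hd]
      norm_num
      exact (abs_of_nonneg (sub_nonneg.2 hyx)).symm
    have key := h.abs_integral_sub_le hα (inv_pos.2 hm) hs (left_mem_Icc.2 zero_le_one)
      hy.1 hyx hx.2
    simp only [h.zero, sub_zero] at key
    refine key.trans ?_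
    have hs1 : |s| ^ (1 - α) ≤ 1 :=
      Real.rpow_le_one (abs_nonneg _) (abs_le.2 ⟨by linarith [hs.1], hs.2⟩) hα1.le
    set m := |x - y| ^ (1 / 2 : ℝ)
    rw [hsq]
    have e : (m⁻¹ * (|s| ^ (1 - α) / (1 - α)) * (m * m) + B / m⁻¹) / 2 =
        (|s| ^ (1 - α) / (1 - α) + B) / 2 * m := by
      field_simp
    rw [e]
    gcongr
    have : |s| ^ (1 - α) / (1 - α) ≤ 1 / (1 - α) := by gcongr
    have : 0 ≤ T / (1 - α) := by positivity
    have : 0 ≤ 1 / (1 - α) := by positivity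
    linarith
  calc _ ≤ _ := _root_.abs_sub_le _ (∫ t in (0 : ℝ)..x, f t s) _
    _ ≤ _ := add_le_add vertical horizontal
    _ = _ := by ring

lemma integral_sq_slice_le (h : HasEnergyBound α T B f p q) (hα : α ∈ Ioo (0 : ℝ) 1) (hT : 0 < T)
    {M : ℝ} {r : ℝ} (hr : r ∈ Icc (0 : ℝ) 1)
    (hM : ∀ x ∈ Icc 0 T, |∫ t in (0 : ℝ)..x, f t r| ≤ M) :
    ∫ t in (0 : ℝ)..T, f t r ^ 2 ≤
      M * ((T / (1 - α) + B) / (2 * T) + T + ∫ t in (0 : ℝ)..T, p t r ^ 2) := by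
  have hα1 : 0 < 1 - α := sub_pos.2 hα.2
  have hf := h.continuous_slice r
  have hp := h.continuous_left_slice r
  have hG := h.continuous_weightedEnergy hα.1.le
  have hM0 : 0 ≤ M := (abs_nonneg _).trans (hM 0 (left_mem_Icc.2 hT.le))
  have hp2 : Continuous fun t => p t r ^ 2 := hp.pow 2
  set J := ∫ t in (0 : ℝ)..T, |p t r|
  have hJ : J ≤ (T + ∫ t in (0 : ℝ)..T, p t r ^ 2) / 2 := by
    have : J ≤ ∫ t in (0 : ℝ)..T, (1 + p t r ^ 2) / 2 :=
      intervalIntegral.integral_mono_on hT.le (hp.abs.intervalIntegrable _ _)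
        (((continuous_const.add hp2).div_const 2).intervalIntegrable _ _) fun t _ => by
          nlinarith [sq_nonneg (|p t r| - 1), sq_abs (p t r)]
    rwa [intervalIntegral.integral_div, intervalIntegral.integral_add
      (continuous_const.intervalIntegrable _ _) (hp2.intervalIntegrable _ _),
      intervalIntegral.integral_const, smul_eq_mul, sub_zero, mul_one] at this
  have hend : |f T r| ≤ (T / (1 - α) + B) / (2 * T) + J := by
    have hpt : ∀ t ∈ Icc 0 T, |f T r| ≤
        (1 / (1 - α) + ∫ v in (0 : ℝ)..1, v ^ α * q t v ^ 2) / 2 + J := by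
      intro t ht
      have h1 : ∫ v in t..T, p v r = f T r - f t r :=
        intervalIntegral.integral_eq_sub_of_hasDerivAt (fun v _ => h.hasDerivAt_left v r)
          (hp.intervalIntegrable _ _)
      have h2 : |f T r - f t r| ≤ J := by
        rw [← h1]
        refine (intervalIntegral.abs_integral_le_integral_abs ht.2).trans ?_
        exact intervalIntegral.integral_mono_interval ht.1 ht.2 le_rfl
          (ae_of_all _ fun v => abs_nonneg _) (hp.abs.intervalIntegrable _ _)
      have h3 := h.abs_sub_le hα one_pos t hr (left_mem_Icc.2 zero_le_one)
      simp only [h.zero, sub_zero, one_mul, div_one] at h3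
      have h4 : |r| ^ (1 - α) / (1 - α) ≤ 1 / (1 - α) := by
        gcongr
        exact Real.rpow_le_one (abs_nonneg _) (abs_le.2 ⟨by linarith [hr.1], hr.2⟩) hα1.le
      have h5 := abs_sub_abs_le_abs_sub (f T r) (f t r)
      linarith
    have hc : Continuous fun t =>
        (1 / (1 - α) + ∫ v in (0 : ℝ)..1, v ^ α * q t v ^ 2) / 2 :=
      (continuous_const.add hG).div_const 2
    have hcJ : Continuous fun t =>
        (1 / (1 - α) + ∫ v in (0 : ℝ)..1, v ^ α * q t v ^ 2) / 2 + J := hc.add continuous_const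
    have hint := intervalIntegral.integral_mono_on (μ := volume) hT.le
      (continuous_const.intervalIntegrable _ _) (hcJ.intervalIntegrable _ _) hpt
    rw [intervalIntegral.integral_add (hc.intervalIntegrable _ _)
      (continuous_const.intervalIntegrable _ _), intervalIntegral.integral_div,
      intervalIntegral.integral_add (continuous_const.intervalIntegrable _ _)
      (hG.intervalIntegrable _ _)] at hint
    simp only [intervalIntegral.integral_const, smul_eq_mul, sub_zero] at hint
    have e : (T / (1 - α) + B) / (2 * T) + J = ((T * (1 / (1 - α)) + B) / 2 + T * J) / T := by
      field_simp
    rw [e, le_div_iff₀ hT]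
    linarith [h.energy_right]
  have hparts := intervalIntegral.integral_mul_deriv_eq_deriv_mul (a := 0) (b := T)
    (u := fun t => f t r) (u' := fun t => p t r) (v := fun x => ∫ t in (0 : ℝ)..x, f t r)
    (v' := fun t => f t r) (fun t _ => h.hasDerivAt_left t r)
    (fun t _ => hf.integral_hasStrictDerivAt 0 t |>.hasDerivAt)
    (hp.intervalIntegrable _ _) (hf.intervalIntegrable _ _)
  simp only [intervalIntegral.integral_same, mul_zero, sub_zero] at hparts
  have hlast : ‖∫ x in (0 : ℝ)..T, p x r * ∫ t in (0 : ℝ)..x, f t r‖ ≤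
      ∫ x in (0 : ℝ)..T, |p x r| * M := by
    refine intervalIntegral.norm_integral_le_of_norm_le hT.le (ae_of_all _ fun x hx => ?_)
      ((hp.abs.mul continuous_const).intervalIntegrable _ _)
    rw [norm_mul]
    exact mul_le_mul_of_nonneg_left (hM x (Ioc_subset_Icc_self hx)) (norm_nonneg _)
  rw [intervalIntegral.integral_mul_const] at hlast
  have hfirst : f T r * (∫ t in (0 : ℝ)..T, f t r) ≤ |f T r| * M :=
    (le_abs_self _).trans ((abs_mul _ _).trans_le
      (mul_le_mul_of_nonneg_left (hM T (right_mem_Icc.2 hT.le)) (abs_nonneg _)))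
  have hcalc : ∫ t in (0 : ℝ)..T, f t r ^ 2 ≤ M * (|f T r| + J) := by
    simp only [pow_two]
    rw [hparts]
    linarith [neg_le_of_abs_le hlast]
  refine hcalc.trans (mul_le_mul_of_nonneg_left ?_ hM0)
  linarith

lemma integral_integral_sq_le (h : HasEnergyBound α T B f p q) (hα : α ∈ Ioo (0 : ℝ) 1)
    (hT : 0 < T) {M : ℝ}
    (hM : ∀ x ∈ Icc 0 T, ∀ r ∈ Icc (0 : ℝ) 1, |∫ t in (0 : ℝ)..x, f t r| ≤ M) :
    ∫ t in (0 : ℝ)..T, ∫ r in (0 : ℝ)..1, f t r ^ 2 ≤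
      M * ((T / (1 - α) + B) / (2 * T) + T + B) := by
  have hM0 : 0 ≤ M :=
    (abs_nonneg _).trans (hM 0 (left_mem_Icc.2 hT.le) 0 (left_mem_Icc.2 zero_le_one))
  have hf2 : Continuous (fun r t => f t r ^ 2).uncurry := (h.cont.comp continuous_swap).pow 2
  have hp2 : Continuous (fun r t => p t r ^ 2).uncurry :=
    (h.cont_left.comp continuous_swap).pow 2
  have hP := continuous_integral_left hp2 0 T
  rw [← integral_integral_swap_of_continuous hf2]
  refine (intervalIntegral.integral_mono_on zero_le_one
    ((continuous_integral_left hf2 0 T).intervalIntegrable _ _)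
    (((continuous_const.add hP).const_mul M).intervalIntegrable _ _) fun r hr =>
      h.integral_sq_slice_le hα hT hr fun x hx => hM x hx r hr).trans ?_
  rw [intervalIntegral.integral_const_mul]
  simp only [Pi.add_apply]
  rw [intervalIntegral.integral_add (continuous_const.intervalIntegrable _ _)
    (hP.intervalIntegrable _ _),
    intervalIntegral.integral_const, smul_eq_mul, sub_zero, one_mul]
  gcongr
  exact h.energy_left

end HasEnergyBound

lemma exists_subseq_integral_integral_sq_sub_lt {α T B : ℝ} (hα : α ∈ Ioo (0 : ℝ) 1) (hT : 0 < T)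
    {f p q : ℕ → ℝ → ℝ → ℝ} (h : ∀ n, HasEnergyBound α T B (f n) (p n) (q n)) :
    ∃ ψ : ℕ → ℕ, StrictMono ψ ∧ ∀ ε : ℝ, 0 < ε → ∃ N : ℕ, ∀ m ≥ N, ∀ k ≥ N,
      ∫ t in (0 : ℝ)..T, ∫ r in (0 : ℝ)..1, (f (ψ m) t r - f (ψ k) t r) ^ 2 < ε := by
  have hα1 : 0 < 1 - α := sub_pos.2 hα.2
  have hB : 0 ≤ B := (h 0).bound_nonneg hT.le
  set K := T / (1 - α) + 1 / (1 - α) + B with hK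
  have hK0 : 0 ≤ K := by positivity
  let X := Icc (0 : ℝ) T × Icc (0 : ℝ) 1
  let b : ℝ → ℝ := fun d => K * (|d| ^ (1 / 2 : ℝ) + |d| ^ ((1 - α) / 2))
  have hb : Tendsto b (𝓝 0) (𝓝 0) := by
    have hc : Continuous b :=
      ((continuous_abs.rpow_const fun _ => Or.inr (by norm_num)).add
        (continuous_abs.rpow_const fun _ => Or.inr (by positivity))).const_mul K
    have h0 : b 0 = 0 := by
      simp only [b, abs_zero]
      rw [Real.zero_rpow (by norm_num), Real.zero_rpow (by positivity)]
      simp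
    simpa [h0] using hc.tendsto 0
  let W : ℕ → X → ℝ := fun n z => ∫ t in (0 : ℝ)..z.1, f n t z.2
  have hW (n : ℕ) (z z' : X) : dist (W n z) (W n z') ≤ b (dist z z') := by
    rw [Real.dist_eq]
    refine ((h n).abs_primitive_sub_le hα z.2.2 z'.2.2 z.1.2 z'.1.2).trans ?_
    have h1 : |(z.1 : ℝ) - z'.1| ≤ |dist z z'| :=
      (le_max_left (dist z.1 z'.1) (dist z.2 z'.2)).trans (le_abs_self _)
    have h2 : |(z.2 : ℝ) - z'.2| ≤ |dist z z'| :=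
      (le_max_right (dist z.1 z'.1) (dist z.2 z'.2)).trans (le_abs_self _)
    simp only [b]
    gcongr
  have hequi : Equicontinuous W :=
    Metric.equicontinuous_of_continuity_modulus b hb W fun z z' n => hW n z z'
  let V : ℕ → BoundedContinuousFunction X ℝ := fun n =>
    BoundedContinuousFunction.mkOfCompact ⟨W n, hequi.continuous n⟩
  have hcompact : IsCompact (closure (range V)) := by
    refine BoundedContinuousFunction.arzela_ascoli
      (Metric.closedBall (0 : ℝ) (K * (T ^ (1 / 2 : ℝ) + 1))) (isCompact_closedBall _ _) _ ?_ ?_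
    · rintro _ z ⟨n, rfl⟩
      rw [mem_closedBall_zero_iff, Real.norm_eq_abs]
      have key := (h n).abs_primitive_sub_le hα z.2.2 (left_mem_Icc.2 zero_le_one) z.1.2
        (left_mem_Icc.2 hT.le)
      simp only [intervalIntegral.integral_same, sub_zero] at key
      refine key.trans ?_
      gcongr
      · rw [abs_of_nonneg z.1.2.1]
        exact z.1.2.2
      · exact Real.rpow_le_one (abs_nonneg _)
          (abs_le.2 ⟨by linarith [z.2.2.1], z.2.2.2⟩) (by positivity)
    · refine Metric.equicontinuous_of_continuity_modulus b hb _ ?_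
      rintro z z' ⟨_, n, rfl⟩
      exact hW n z z'
  obtain ⟨_, -, ψ, hψ, hlim⟩ :=
    hcompact.tendsto_subseq fun n => subset_closure (mem_range_self (f := V) n)
  refine ⟨ψ, hψ, fun ε hε => ?_⟩
  set C := (T / (1 - α) + 4 * B) / (2 * T) + T + 4 * B
  have hC : 0 < C := by positivity
  obtain ⟨N, hN⟩ := Metric.cauchySeq_iff.1 hlim.cauchySeq (ε / (2 * C)) (by positivity)
  refine ⟨N, fun m hm k hk => ?_⟩
  have hM : ∀ x ∈ Icc 0 T, ∀ r ∈ Icc (0 : ℝ) 1,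
      |∫ t in (0 : ℝ)..x, (f (ψ m) t r - f (ψ k) t r)| ≤ ε / (2 * C) := by
    intro x hx r hr
    rw [intervalIntegral.integral_sub (((h _).continuous_slice r).intervalIntegrable _ _)
      (((h _).continuous_slice r).intervalIntegrable _ _)]
    exact (BoundedContinuousFunction.dist_coe_le_dist (f := V (ψ m)) (g := V (ψ k))
      ((⟨x, hx⟩, ⟨r, hr⟩) : X)).trans (hN m hm k hk).le
  refine (((h (ψ m)).sub (h (ψ k)) hα.1.le hT.le).integral_integral_sq_le hα hT hM).trans_lt ?_
  have : ε / (2 * C) * C = ε / 2 := by field_simp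
  linarith

lemma integral_Ioo_integral_Ioo_eq {F G : ℝ → ℝ → ℝ} {a b c d : ℝ} (hab : a ≤ b) (hcd : c ≤ d)
    (h : ∀ x ∈ Ioo a b, ∀ y ∈ Ioo c d, F x y = G x y) :
    ∫ x in Ioo a b, ∫ y in Ioo c d, F x y = ∫ x in a..b, ∫ y in c..d, G x y := by
  simp only [intervalIntegral.integral_of_le hab, intervalIntegral.integral_of_le hcd,
    integral_Ioc_eq_integral_Ioo]
  exact setIntegral_congr_fun measurableSet_Ioo fun x hx =>
    setIntegral_congr_fun measurableSet_Ioo fun y hy => h x hx y hy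

lemma hasEnergyBound_of_contDiffOn {α T B : ℝ} (hα : 0 ≤ α) (hT : 0 ≤ T) {u : ℝ → ℝ → ℝ}
    (hu : ContDiffOn ℝ 1 (fun z : ℝ × ℝ => u z.1 z.2) (univ ×ˢ Icc 0 1))
    (hu0 : ∀ θ, u θ 0 = 0)
    (hB : ∫ θ in Ioo 0 T, ∫ r in Ioo (0 : ℝ) 1,
      (deriv (fun x => u x r) θ ^ 2 + r ^ α * deriv (u θ) r ^ 2) ≤ B) :
    ∃ p q, HasEnergyBound α T B (fun θ r => u θ (projIcc 0 1 zero_le_one r)) p q := by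
  set S : Set (ℝ × ℝ) := univ ×ˢ Icc 0 1
  set F : ℝ × ℝ → ℝ := fun z => u z.1 z.2
  have hS : UniqueDiffOn ℝ S := uniqueDiffOn_univ.prod (uniqueDiffOn_Icc zero_lt_one)
  let c : ℝ × ℝ → ℝ × ℝ := fun z => (z.1, projIcc (0 : ℝ) 1 zero_le_one z.2)
  have hc : Continuous c := continuous_fst.prodMk
    (continuous_subtype_val.comp (continuous_projIcc.comp continuous_snd))
  have hcS (z : ℝ × ℝ) : c z ∈ S := ⟨mem_univ _, Subtype.coe_prop _⟩
  have hc_eq {θ r : ℝ} (hr : r ∈ Icc (0 : ℝ) 1) : c (θ, r) = (θ, r) := by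
    simp only [c, projIcc_of_mem zero_le_one hr]
  have hD : Continuous fun z => fderivWithin ℝ F S (c z) :=
    (hu.continuousOn_fderivWithin hS le_rfl).comp_continuous hc hcS
  have hFd {z : ℝ × ℝ} (hz : z ∈ S) : HasFDerivWithinAt F (fderivWithin ℝ F S z) S z :=
    ((hu.differentiableOn one_ne_zero) z hz).hasFDerivWithinAt
  let p : ℝ → ℝ → ℝ := fun θ r => fderivWithin ℝ F S (c (θ, r)) (1, 0)
  let q : ℝ → ℝ → ℝ := fun θ r => fderivWithin ℝ F S (c (θ, r)) (0, 1)
  have hp : Continuous p.uncurry := hD.clm_apply continuous_const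
  have hq : Continuous q.uncurry := hD.clm_apply continuous_const
  have hleft (θ r : ℝ) :
      HasDerivAt (fun x => u x (projIcc (0 : ℝ) 1 zero_le_one r)) (p θ r) θ := by
    have hg : HasDerivAt (fun x : ℝ => c (x, r)) ((1 : ℝ), (0 : ℝ)) θ :=
      (hasDerivAt_id θ).prodMk (hasDerivAt_const θ (projIcc (0 : ℝ) 1 zero_le_one r : ℝ))
    have := (hFd (hcS (θ, r))).comp_hasDerivWithinAt (s := univ) θ hg.hasDerivWithinAt
      fun x _ => hcS (x, r)
    exact hasDerivWithinAt_univ.1 this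
  have hright {θ r : ℝ} (hr : r ∈ Ioo (0 : ℝ) 1) : HasDerivAt (u θ) (q θ r) r := by
    have hg : HasDerivAt (fun x : ℝ => (θ, x)) ((0 : ℝ), (1 : ℝ)) r :=
      (hasDerivAt_const r θ).prodMk (hasDerivAt_id r)
    have hr' := Ioo_subset_Icc_self hr
    have hz : (θ, r) ∈ S := ⟨mem_univ _, hr'⟩
    have := (hFd hz).comp_hasDerivWithinAt (s := Icc 0 1) r hg.hasDerivWithinAt
      fun x hx => ⟨mem_univ _, hx⟩
    have := this.hasDerivAt (Icc_mem_nhds hr.1 hr.2)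
    simp only [q, hc_eq hr']
    exact this
  have hpq : ∫ θ in (0 : ℝ)..T, ∫ r in (0 : ℝ)..1, (p θ r ^ 2 + r ^ α * q θ r ^ 2) ≤ B := by
    refine (integral_Ioo_integral_Ioo_eq hT zero_le_one fun θ _ r hr => ?_).symm.trans_le hB
    have := (hleft θ r).deriv
    rw [projIcc_of_mem zero_le_one (Ioo_subset_Icc_self hr)] at this
    rw [this, (hright hr).deriv]
  have hp2 : Continuous (fun θ r => p θ r ^ 2).uncurry := hp.pow 2
  have hq2 : Continuous (fun θ r => r ^ α * q θ r ^ 2).uncurry :=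
    ((Real.continuous_rpow_const hα).comp continuous_snd).mul (hq.pow 2)
  have hsum : Continuous (fun θ r => p θ r ^ 2 + r ^ α * q θ r ^ 2).uncurry := hp2.add hq2
  refine ⟨p, q, hu.continuousOn.comp_continuous hc hcS, hp, hq, hleft, fun θ r hr => ?_,
    fun θ => ?_, ?_, ?_⟩
  · refine (hright hr).congr_of_eventuallyEq ?_
    filter_upwards [Icc_mem_nhds hr.1 hr.2] with x hx
    rw [projIcc_of_mem zero_le_one hx]
  · rw [projIcc_left]
    exact hu0 θ
  · rw [← integral_integral_swap_of_continuous hp2]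
    exact (integral_integral_mono hp2 hsum hT zero_le_one fun θ _ r hr =>
      le_add_of_nonneg_right (mul_nonneg (Real.rpow_nonneg hr.1 α) (sq_nonneg _))).trans hpq
  · exact (integral_integral_mono hq2 hsum hT zero_le_one fun θ _ r _ =>
      le_add_of_nonneg_left (sq_nonneg _)).trans hpq

/-- **Compactness of the embedding `H¹₀(Ω;w) ↪ L²(Ω)`, sequential form**
(Lemma 2.2 of the paper), for `Ω = 𝕋 × (0,1)` and `w(r) = r^α`.
The torus `𝕋 = ℝ/2πℤ` is modelled by `2π`-periodic functions of `θ ∈ ℝ`, with the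
integral over `𝕋` realized as the integral over `(0, 2π)`; the Cauchy property is
stated for the `L²` norms of differences. -/
theorem stmt_5 (α : ℝ) (hα : α ∈ Set.Ioo (0 : ℝ) 1) (u : ℕ → ℝ → ℝ → ℝ)
    (hC1 : ∀ n, ContDiffOn ℝ 1 (fun p : ℝ × ℝ => u n p.1 p.2) (Set.univ ×ˢ Set.Icc 0 1))
    (hper : ∀ n, ∀ θ r : ℝ, u n (θ + 2 * Real.pi) r = u n θ r)
    (hbd0 : ∀ n, ∀ θ : ℝ, u n θ 0 = 0)
    (hbd1 : ∀ n, ∀ θ : ℝ, u n θ 1 = 0)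
    (hbound : ∃ B : ℝ, ∀ n,
      (∫ θ in Set.Ioo 0 (2 * Real.pi), ∫ r in Set.Ioo (0 : ℝ) 1,
          ((deriv (fun x => u n x r) θ) ^ 2 + r ^ α * (deriv (u n θ) r) ^ 2)) ≤ B) :
    ∃ ψ : ℕ → ℕ, StrictMono ψ ∧
      ∀ ε : ℝ, 0 < ε → ∃ N : ℕ, ∀ m ≥ N, ∀ k ≥ N,
        Real.sqrt (∫ θ in Set.Ioo 0 (2 * Real.pi), ∫ r in Set.Ioo (0 : ℝ) 1,
            (u (ψ m) θ r - u (ψ k) θ r) ^ 2) < ε := by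
  obtain ⟨B, hB⟩ := hbound
  have hT : 0 < 2 * Real.pi := Real.two_pi_pos
  choose p q hpq using fun n =>
    hasEnergyBound_of_contDiffOn hα.1.le hT.le (hC1 n) (hbd0 n) (hB n)
  obtain ⟨ψ, hψ, hcauchy⟩ := exists_subseq_integral_integral_sq_sub_lt hα hT hpq
  refine ⟨ψ, hψ, fun ε hε => ?_⟩
  obtain ⟨N, hN⟩ := hcauchy (ε ^ 2) (by positivity)
  refine ⟨N, fun m hm k hk => (Real.sqrt_lt' hε).2 ?_⟩
  refine (integral_Ioo_integral_Ioo_eq hT.le zero_le_one fun θ _ r hr => ?_).trans_lt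
    (hN m hm k hk)
  rw [projIcc_of_mem zero_le_one (Ioo_subset_Icc_self hr)]
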